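/- Let w ∈ W^odd ∩ W^P with w(1) > 1 and let α ∈ BKT(k,2n+1) correspond to w under the BKT bijection. Then: (1) if w = (a_1 < a_2 < ⋯ < a_k) with a_k ≤ n+1, then α_k ≥ 1; (2) if w = (a_1 < a_2 < ⋯ < a_r < \overline{a_k} < ⋯ < \overline{a_{r+1}}) and {2, 3, …, a_{r+1}} is not contained in {a_1, a_2, …, a_k}, then α_k ≥ 1; (3) if w = (a_1 < a_2 < ⋯ < a_r < \overline{a_k} < ⋯ < \overline{a_{r+1}}) and {2, 3, …, a_k} ⊆ {a_1, a_2, …, a_k}, then α_{r+1} = 0 and α_k = 0; (4) if w = (a_1 < ⋯ < a_r < \overline{a_k} < ⋯ < \overline{a_{t+1}} < \overline{a_t} < ⋯ < \overline{a_{r+1}}) where t is the largest index such that {2, 3, …, a_t} ⊆ {a_1, …, a_k}, and s is the index with w(s) = \overline{a_t}, then α_s = 0 and α_k = 0. -/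

import Mathlib

/-!
Common framework: the Weyl group of type `C_{m+1}` realized as signed permutations
of `Fin (2*m+2)` (values 0-indexed: the paper's 1-indexed value `a ∈ {1, …, 2m+2}`
corresponds to `a-1`, and the paper's `bar a = 2m+3-a` corresponds to `2m+2-a`).
For the odd symplectic Grassmannian `IG(k, 2n+1)` one takes `m = n`;
the smaller group `W_{2n}` of type `C_n` corresponds to `m = n-1`.
-/

namespace OddSymplectic

open Equiv

noncomputable section

/-- The element of `Fin (2*m+2)` with (0-indexed) value `i`. -/
def fn (m i : ℕ) : Fin (2*m+2) := ⟨i % (2*m+2), Nat.mod_lt _ (by omega)⟩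

/-- The bar involution on values. -/
def bar (m : ℕ) (j : Fin (2*m+2)) : Fin (2*m+2) := ⟨2*m+1 - (j:ℕ), by omega⟩

def barPerm (m : ℕ) : Equiv.Perm (Fin (2*m+2)) :=
  Function.Involutive.toPerm (bar m) (fun j => by
    have hj := j.isLt
    apply Fin.ext
    simp [bar]
    omega)

/-- The Weyl group of type `C_{m+1}`: the permutations of `Fin (2*m+2)` commuting with
the bar involution (signed permutations). -/
def Weyl (m : ℕ) : Subgroup (Equiv.Perm (Fin (2*m+2))) :=
  Subgroup.centralizer {barPerm m}

/-- The simple reflection `s_i`, `1 ≤ i ≤ m+1`. -/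
def sRefl (m i : ℕ) : Equiv.Perm (Fin (2*m+2)) :=
  if i ≤ m then
    Equiv.swap (fn m (i-1)) (fn m i) * Equiv.swap (fn m (2*m+2-i)) (fn m (2*m+1-i))
  else
    Equiv.swap (fn m m) (fn m (m+1))

/-- Coxeter length: the minimal length of an expression as a product of simple reflections. -/
def len (m : ℕ) (w : Equiv.Perm (Fin (2*m+2))) : ℕ :=
  sInf {r | ∃ l : List ℕ, l.length = r ∧ (∀ i ∈ l, 1 ≤ i ∧ i ≤ m+1) ∧
    (l.map (sRefl m)).prod = w}

/-- The set of reflections. -/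
def reflections (m : ℕ) : Set (Equiv.Perm (Fin (2*m+2))) :=
  {t | ∃ u ∈ Weyl m, ∃ i, 1 ≤ i ∧ i ≤ m+1 ∧ t = u * sRefl m i * u⁻¹}

/-- The Bruhat order. -/
def bruhatLE (m : ℕ) (u w : Equiv.Perm (Fin (2*m+2))) : Prop :=
  Relation.ReflTransGen (fun a b => ∃ t ∈ reflections m, b = a * t ∧ len m a < len m b) u w

/-- The parabolic subgroup `W_P` generated by the simple reflections `s_i`, `i ≠ kk`. -/
def WP (m kk : ℕ) : Subgroup (Equiv.Perm (Fin (2*m+2))) :=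
  Subgroup.closure {x | ∃ i, 1 ≤ i ∧ i ≤ m+1 ∧ i ≠ kk ∧ x = sRefl m i}

/-- `x W_P = y W_P`. -/
def cosetEq (m kk : ℕ) (x y : Equiv.Perm (Fin (2*m+2))) : Prop := x⁻¹ * y ∈ WP m kk

/-- `w ∈ W^P`: `w` is a minimal length representative of its coset `w W_P`. -/
def isMinRep (m kk : ℕ) (w : Equiv.Perm (Fin (2*m+2))) : Prop :=
  w ∈ Weyl m ∧ ∀ v ∈ WP m kk, len m w ≤ len m (w * v)

/-- `w ∈ W^{odd}`: `w(j) ≠ bar 1` for all `1 ≤ j ≤ m+1` (1-indexed positions). -/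
def isOdd (m : ℕ) (w : Equiv.Perm (Fin (2*m+2))) : Prop :=
  ∀ j : Fin (2*m+2), (j:ℕ) ≤ m → w j ≠ fn m (2*m+1)

/-- `w ∈ W°`: odd symplectic permutations with `w(j) ≠ 1` for `1 ≤ j ≤ kk`. -/
def isOpen (m kk : ℕ) (w : Equiv.Perm (Fin (2*m+2))) : Prop :=
  isOdd m w ∧ ∀ j : Fin (2*m+2), (j:ℕ) < kk → w j ≠ fn m 0

/-- `φ(u)`: the number of barred entries among the first `kk` values of `u`. -/
def phi (m kk : ℕ) (u : Equiv.Perm (Fin (2*m+2))) : ℕ :=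
  (Finset.univ.filter (fun j : Fin (2*m+2) => (j:ℕ) < kk ∧ m+1 ≤ ((u j : ℕ)))).card

/-- The set of values of `w` on the first `kk` positions. -/
def valSet (m kk : ℕ) (w : Equiv.Perm (Fin (2*m+2))) : Finset (Fin (2*m+2)) :=
  (Finset.univ.filter (fun j : Fin (2*m+2) => (j:ℕ) < kk)).image w

/-- The (1-indexed) absolute value `|x|` of a signed entry. -/
def absVal (m : ℕ) (x : Fin (2*m+2)) : ℕ :=
  if (x:ℕ) ≤ m then (x:ℕ)+1 else 2*m+2-(x:ℕ)

/-! ### Hecke products -/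

def hStep (m : ℕ) (w : Equiv.Perm (Fin (2*m+2))) (i : ℕ) : Equiv.Perm (Fin (2*m+2)) :=
  if len m w < len m (w * sRefl m i) then w * sRefl m i else w

/-- Hecke product of `w` with the word `l` of simple reflections. -/
def hWord (m : ℕ) (w : Equiv.Perm (Fin (2*m+2))) (l : List ℕ) : Equiv.Perm (Fin (2*m+2)) :=
  l.foldl (hStep m) w

def hStepK (m kk : ℕ) (w : Equiv.Perm (Fin (2*m+2))) (i : ℕ) : Equiv.Perm (Fin (2*m+2)) :=
  if len m w < len m (w * sRefl m i) ∨ i = kk then w * sRefl m i else w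

/-- Modified Hecke product `·_k` of `w` with the word `l`. -/
def hWordK (m kk : ℕ) (w : Equiv.Perm (Fin (2*m+2))) (l : List ℕ) : Equiv.Perm (Fin (2*m+2)) :=
  l.foldl (hStepK m kk) w

/-- The list `[a, a+1, …, b]`. -/
def ascList (a b : ℕ) : List ℕ := List.range' a (b+1-a)

/-- The word `s_1 s_2 ⋯ s_{m+1} ⋯ s_2 s_1` for `O^∘(1)`. -/
def wordOcirc1 (m : ℕ) : List ℕ := ascList 1 (m+1) ++ (ascList 1 m).reverse

/-- The word `s_1 ⋯ s_{kk-1} s_{kk+1} ⋯ s_{m+1} ⋯ s_2 s_1` for `O_Y(1)`. -/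
def wordOY1 (m kk : ℕ) : List ℕ :=
  ascList 1 (kk-1) ++ ascList (kk+1) (m+1) ++ (ascList 1 m).reverse

/-- The word `s_2 ⋯ s_{m+1} ⋯ s_2` for `O_Z(1)`. -/
def wordOZ1 (m : ℕ) : List ℕ := ascList 2 (m+1) ++ (ascList 2 m).reverse

def wordOcirc (m d : ℕ) : List ℕ := (List.replicate d (wordOcirc1 m)).flatten
def wordOZ (m d : ℕ) : List ℕ := (List.replicate d (wordOZ1 m)).flatten

/-- `w ·_k O^∘(d)`. -/
def mulOcirc (m kk : ℕ) (w : Equiv.Perm (Fin (2*m+2))) (d : ℕ) : Equiv.Perm (Fin (2*m+2)) :=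
  hWordK m kk w (wordOcirc m d)

/-- `w · O_Z(d)`. -/
def mulOZ (m : ℕ) (w : Equiv.Perm (Fin (2*m+2))) (d : ℕ) : Equiv.Perm (Fin (2*m+2)) :=
  hWord m w (wordOZ m d)

/-- `w · O_Y(1)`. -/
def mulOY1 (m kk : ℕ) (w : Equiv.Perm (Fin (2*m+2))) : Equiv.Perm (Fin (2*m+2)) :=
  hWord m w (wordOY1 m kk)

/-- `w · O_Y(d) = (w · O_Y(1)) ·_k O^∘(d-1)`. -/
def mulOY (m kk : ℕ) (w : Equiv.Perm (Fin (2*m+2))) (d : ℕ) : Equiv.Perm (Fin (2*m+2)) :=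
  mulOcirc m kk (mulOY1 m kk w) (d-1)

/-! ### Positive roots of type `C_{m+1}` -/

/-- Positive roots of type `C_{m+1}` (1-indexed `i < j ≤ m+1`). -/
inductive PosRoot : Type
  | tm (i j : ℕ)   -- `t_i - t_j`
  | tp (i j : ℕ)   -- `t_i + t_j`
  | lg (i : ℕ)     -- `2 t_i`

def PosRoot.valid (m : ℕ) : PosRoot → Prop
  | .tm i j => 1 ≤ i ∧ i < j ∧ j ≤ m+1
  | .tp i j => 1 ≤ i ∧ i < j ∧ j ≤ m+1
  | .lg i => 1 ≤ i ∧ i ≤ m+1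

/-- The reflection `s_α`. -/
def PosRoot.refl (m : ℕ) : PosRoot → Equiv.Perm (Fin (2*m+2))
  | .tm i j => Equiv.swap (fn m (i-1)) (fn m (j-1)) *
      Equiv.swap (fn m (2*m+2-i)) (fn m (2*m+2-j))
  | .tp i j => Equiv.swap (fn m (i-1)) (fn m (2*m+2-j)) *
      Equiv.swap (fn m (j-1)) (fn m (2*m+2-i))
  | .lg i => Equiv.swap (fn m (i-1)) (fn m (2*m+2-i))

/-- The coefficient of the simple root `α_kk` in the expansion of `α` in simple roots. -/
def PosRoot.rootCoeff (m kk : ℕ) : PosRoot → ℕ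
  | .tm i j => if i ≤ kk ∧ kk < j then 1 else 0
  | .tp i j => if i ≤ kk ∧ kk < j then 1 else if j ≤ kk ∧ kk ≤ m then 2
      else if j ≤ kk then 1 else 0
  | .lg i => if i ≤ kk ∧ kk ≤ m then 2 else if i ≤ kk then 1 else 0

/-- The coefficient of the simple coroot `α_kk^∨` in the expansion of `α^∨` in simple
coroots: the degree of the corresponding edge of the moment graph. -/
def PosRoot.corootCoeff (kk : ℕ) : PosRoot → ℕ
  | .tm i j => if i ≤ kk ∧ kk < j then 1 else 0
  | .tp i j => if i ≤ kk ∧ kk < j then 1 else if j ≤ kk then 2 else 0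
  | .lg i => if i ≤ kk then 1 else 0

/-- `α ∈ R_1^+`. -/
def PosRoot.inR1 (m kk : ℕ) : PosRoot → Bool
  | .tm i j => decide (1 ≤ i ∧ i ≤ kk ∧ kk < j ∧ j ≤ m+1)
  | .tp i j => decide (1 ≤ i ∧ i ≤ kk ∧ kk < j ∧ j ≤ m+1)
  | .lg i => decide (1 ≤ i ∧ i ≤ kk)

/-- `α ∈ R_2^+`. -/
def PosRoot.inR2 (kk : ℕ) : PosRoot → Bool
  | .tp i j => decide (1 ≤ i ∧ i < j ∧ j ≤ kk)
  | _ => false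

/-- Chains in the moment graph of `IG(kk, 2m+2)`, recorded with their list of roots:
each step goes from the vertex `u W_P` to the vertex with minimal length representative
`v`, where `v W_P = u s_α W_P` and `α ∈ R^+ \ R_P^+`. -/
inductive Chain (m kk : ℕ) :
    Equiv.Perm (Fin (2*m+2)) → Equiv.Perm (Fin (2*m+2)) → List PosRoot → Prop
  | nil (u : Equiv.Perm (Fin (2*m+2))) : Chain m kk u u []
  | cons {u w : Equiv.Perm (Fin (2*m+2))} {l : List PosRoot}
      (a : PosRoot) (v : Equiv.Perm (Fin (2*m+2))) :
      a.valid m → a.rootCoeff m kk ≠ 0 → isMinRep m kk v →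
      cosetEq m kk v (u * a.refl m) → Chain m kk v w l → Chain m kk u w (a :: l)

/-- The degree of a chain: the sum of the degrees of its edges. -/
def chainDeg (kk : ℕ) (l : List PosRoot) : ℕ := (l.map (PosRoot.corootCoeff kk)).sum

/-- Chains of a given total degree in the moment graph of `IG(kk, 2m+1)`
(the full subgraph of the moment graph of `IG(kk, 2m+2)` on `W^P ∩ W^{odd}`). -/
inductive ChainO (m kk : ℕ) :
    Equiv.Perm (Fin (2*m+2)) → Equiv.Perm (Fin (2*m+2)) → ℕ → Prop
  | nil (u : Equiv.Perm (Fin (2*m+2))) : ChainO m kk u u 0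
  | cons {u w : Equiv.Perm (Fin (2*m+2))} {d : ℕ}
      (a : PosRoot) (v : Equiv.Perm (Fin (2*m+2))) :
      a.valid m → a.rootCoeff m kk ≠ 0 → isMinRep m kk v → isOdd m v →
      cosetEq m kk v (u * a.refl m) → ChainO m kk v w d →
      ChainO m kk u w (a.corootCoeff kk + d)

/-! ### The maps `Φ`, `Φ_Z`, `ψ` -/

/-- The relation `Φ(w W_P) = w' W_Y`, for `w` in the type `C_{n+1}` group and `w'` in the
type `C_n` group (entrywise shift of the first `kk` values). -/
def PhiRel (n kk : ℕ) (w : Equiv.Perm (Fin (2*n+2)))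
    (w' : Equiv.Perm (Fin (2*(n-1)+2))) : Prop :=
  ∀ j, j < kk → ((w' (fn (n-1) j) : ℕ) + 1 = (w (fn n j) : ℕ))

/-- The relation `Φ_Z(w W_P) = w' W_Z` (entrywise shift of the values in positions
`2, …, kk`). -/
def PhiZRel (n kk : ℕ) (w : Equiv.Perm (Fin (2*n+2)))
    (w' : Equiv.Perm (Fin (2*(n-1)+2))) : Prop :=
  ∀ j, j + 1 < kk → ((w' (fn (n-1) j) : ℕ) + 1 = (w (fn n (j+1)) : ℕ))

/-- The word `ψ(s_i)`. -/
def psiWord (kk i : ℕ) : List ℕ :=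
  if i ≤ kk-1 then [i] else if i = kk then [kk, kk+1, kk] else [i+1]

/-- `j ↦ min({2,…,m+1} \ {|w(p)|, …, |w(kk)|})` (1-indexed positions `p ≤ j ≤ kk`). -/
def jmin (m kk p : ℕ) (w : Equiv.Perm (Fin (2*m+2))) : ℕ :=
  sInf {i | 2 ≤ i ∧ i ≤ m+1 ∧ ∀ j, p ≤ j → j ≤ kk → absVal m (w (fn m (j-1))) ≠ i}

/-! ### Partitions -/

/-- `μ ∈ Part(k, N)`, encoded as a function `ℕ → ℤ` supported on `{1, …, k}`. -/
def IsPart (k N : ℕ) (μ : ℕ → ℤ) : Prop :=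
  (∀ j, 1 ≤ j → j < k → μ (j+1) ≤ μ j) ∧ μ 1 ≤ (N:ℤ) - k ∧
  (∀ j, 1 ≤ j → j ≤ k → 0 ≤ μ j) ∧ (∀ j, j = 0 ∨ k < j → μ j = 0)

/-- `D(μ)(i)`: the `i`-th step of the boundary path of the Young diagram of `μ` inside
the `k × (N-k)` rectangle (from northeast to southwest) is vertical. -/
def Dword (k N : ℕ) (μ : ℕ → ℤ) (i : ℕ) : Prop :=
  ∃ j, 1 ≤ j ∧ j ≤ k ∧ (i:ℤ) = (N:ℤ) - k - μ j + j

/-- `μ ∈ BC(k, 2n+2)`. -/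
def IsBCeven (n k : ℕ) (μ : ℕ → ℤ) : Prop :=
  IsPart k (2*n+2) μ ∧
  ∀ i, 1 ≤ i → i ≤ n+1 → ¬(Dword k (2*n+2) μ i ∧ Dword k (2*n+2) μ (2*n+3-i))

/-- `λ + 1^k`. -/
def addOne (k : ℕ) (lam : ℕ → ℤ) (j : ℕ) : ℤ := if 1 ≤ j ∧ j ≤ k then lam j + 1 else 0

/-- `λ ∈ BC(k, 2n+1)`: `λ ∈ Part(k, 2n+1)` and `λ + 1^k ∈ BC(k, 2n+2)`. -/
def IsBCodd (n k : ℕ) (lam : ℕ → ℤ) : Prop :=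
  IsPart k (2*n+1) lam ∧ IsBCeven n k (addOne k lam)

/-- `β ∈ BKT(k, 2n+2)`: `(n+1-k)`-strict partitions. -/
def IsBKTeven (n k : ℕ) (β : ℕ → ℤ) : Prop :=
  IsPart k (2*n+2) β ∧ ∀ j, 1 ≤ j → j < k → ((n:ℤ)+1-k < β j → β (j+1) < β j)

/-- `α ∈ BKT(k, 2n+1)`: `α = β - 1^k` with `β ∈ BKT(k, 2n+2)`. -/
def IsBKTodd (n k : ℕ) (α : ℕ → ℤ) : Prop :=
  IsBKTeven n k (addOne k α) ∧ (∀ j, j = 0 ∨ k < j → α j = 0)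

/-- `ℓ(λ)`: the number of nonzero parts. -/
def numParts (k : ℕ) (lam : ℕ → ℤ) : ℕ :=
  ((Finset.Icc 1 k).filter (fun j => lam j ≠ 0)).card

/-- `ℓ_i^d(λ) = #{j > d : λ_j > i}`. -/
def elld (k : ℕ) (lam : ℕ → ℤ) (i : ℤ) (d : ℕ) : ℕ :=
  ((Finset.Icc 1 k).filter (fun j => d < j ∧ i < lam j)).card

/-- `λ^{O∘(1)} = (λ_2-1, …, λ_{ℓ(λ)}-1, 0, …, 0)`. -/
def Oc1 (k : ℕ) (lam : ℕ → ℤ) (j : ℕ) : ℤ :=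
  if 1 ≤ j ∧ j + 1 ≤ numParts k lam then lam (j+1) - 1 else 0

/-- `λ^{O∘(d)}`. -/
def OcD (k : ℕ) (lam : ℕ → ℤ) : ℕ → ℕ → ℤ
  | 0 => lam
  | d+1 => Oc1 k (OcD k lam d)

/-- `λ^{O_Z(1)} = (λ_1, λ_3-1, …, λ_{ℓ(λ)}-1, 0, …, 0)` for `λ ∈ BC(k, 2n+1)`. -/
def OZ1 (k : ℕ) (lam : ℕ → ℤ) (j : ℕ) : ℤ :=
  if j = 1 then lam 1
  else if 2 ≤ j ∧ j + 1 ≤ numParts k lam then lam (j+1) - 1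
  else 0

/-- `λ^{O_Z(d)}`. -/
def OZd (k : ℕ) (lam : ℕ → ℤ) : ℕ → ℕ → ℤ
  | 0 => lam
  | d+1 => OZ1 k (OZd k lam d)

/-- `Comp_BC(d)`. -/
def CompBC (n k d : ℕ) (lam : ℕ → ℤ) : Prop :=
  IsBCodd n k lam ∧ lam 1 = 2*(n:ℤ)+1-k ∧
  lam (d+1) - (elld k lam ((d:ℤ)-1) (d+1) : ℤ) - d = 2*((n:ℤ)+1-k)

/-- The transposed partition. -/
def transpose (k : ℕ) (μ : ℕ → ℤ) (j : ℕ) : ℤ :=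
  if 1 ≤ j then (((Finset.Icc 1 k).filter (fun i => (j:ℤ) ≤ μ i)).card : ℤ) else 0

/-- `D(μ)(i) = D(μ^t)(i)`. -/
def wingAgree (n k : ℕ) (μ : ℕ → ℤ) (i : ℕ) : Prop :=
  Dword k (2*n+2) μ i ↔ Dword (2*n+2-k) (2*n+2) (transpose k μ) i

/-- `μ ∈ Part(k, 2n+2)` is `m`-wingtip symmetric. -/
def isWingtipEven (n k : ℕ) (μ : ℕ → ℤ) (m : ℕ) : Prop :=
  (∀ i, 1 ≤ i → i ≤ m → wingAgree n k μ i) ∧ (m = 2*n+2 ∨ ¬ wingAgree n k μ (m+1))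

/-- `λ ∈ BC(k, 2n+1)` is `m`-wingtip symmetric. -/
def isWingtip (n k : ℕ) (lam : ℕ → ℤ) (m : ℕ) : Prop :=
  isWingtipEven n k (addOne k lam) m

open scoped Classical in
/-- `λ^{O_Y(1)}` for an `m`-wingtip symmetric `λ ∈ BC(k, 2n+1)` with `λ_1 = 2n+1-k`. -/
def OY1 (n k m : ℕ) (lam : ℕ → ℤ) : ℕ → ℤ :=
  -- the step of `D(λ)` at position `bar m = 2n+3-m`
  let s := 2*n+3-m
  -- the row at (or just above) the step at position `s`
  let i := ((Finset.Icc 1 s).filter (fun t => Dword k (2*n+2) (addOne k lam) t)).card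
  -- the column of the step at position `s` (when horizontal)
  let j := (2*n+2-k) + 1 -
    ((Finset.Icc 1 s).filter (fun t => ¬ Dword k (2*n+2) (addOne k lam) t)).card
  if Dword k (2*n+2) (addOne k lam) s then
    -- `D(λ)(bar m) = 1` is the `i`-th 1: `(λ_2-1, …, λ_{i-1}-1, λ_i, λ_i, λ_{i+1}, …, λ_k)`
    fun p =>
      if 1 ≤ p ∧ p + 2 ≤ i then lam (p+1) - 1
      else if (p = i - 1 ∨ p = i) ∧ 1 ≤ p ∧ p ≤ k then lam i
      else if i + 1 ≤ p ∧ p ≤ k then lam p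
      else 0
  else
    -- horizontal step at the bottom of row `i`, column `j`:
    -- `(λ_2-1, …, λ_i-1, j, λ_{i+1}, …, λ_k)`
    fun p =>
      if 1 ≤ p ∧ p + 1 ≤ i then lam (p+1) - 1
      else if p = i ∧ 1 ≤ p ∧ p ≤ k then (j:ℤ)
      else if i + 1 ≤ p ∧ p ≤ k then lam p
      else 0

/-- `λ^{O_Y(d)} = (λ^{O_Y(1)})^{O∘(d-1)}`. -/
def OYd (n k m : ℕ) (lam : ℕ → ℤ) (d : ℕ) : ℕ → ℤ := OcD k (OY1 n k m lam) (d-1)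

open scoped Classical in
/-- `α^{O_Z(1)}` for `α ∈ BKT(k, 2n+1)` with `α_1 = 2n+1-k`. -/
def OZ1bkt (n k : ℕ) (α : ℕ → ℤ) : ℕ → ℤ :=
  if ∃ j, 3 ≤ j ∧ j ≤ k ∧ α 2 + α j ≤ 2*((n:ℤ)-k)+j-2 then
    -- `j0` minimal such that `α_2 + α_{j0} ≤ 2(n-k)+j0-2`
    let j0 := sInf {j | 3 ≤ j ∧ j ≤ k ∧ α 2 + α j ≤ 2*((n:ℤ)-k)+j-2}
    fun p =>
      if p = 1 then α 1
      else if 2 ≤ p ∧ p + 2 ≤ j0 then α (p+1)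
      else if j0 ≤ p + 1 ∧ p + 1 ≤ k then max (α (p+1) - 1) (-1)
      else if p = k then -1 else 0
  else
    fun p =>
      if p = 1 then α 1
      else if 2 ≤ p ∧ p + 1 ≤ k then α (p+1)
      else if p = k then -1 else 0

/-- `α^{O_Z(d)}`. -/
def OZdbkt (n k : ℕ) (α : ℕ → ℤ) : ℕ → ℕ → ℤ
  | 0 => α
  | d+1 => OZ1bkt n k (OZdbkt n k α d)

/-- `Comp_BKT(d)`. -/
def CompBKT (n k d : ℕ) (α : ℕ → ℤ) : Prop :=
  IsBKTodd n k α ∧ α 1 = 2*(n:ℤ)+1-k ∧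
  (OZdbkt n k α (d-1)) 2 - (elld k (OZdbkt n k α (d-1)) (-1) 2 : ℤ) = 2*((n:ℤ)+1-k)

/-- `ℓ_{-1}(α) = max {j : α_j > -1}`. -/
def ellNeg (k : ℕ) (α : ℕ → ℤ) : ℕ :=
  ((Finset.Icc 1 k).filter (fun j => (-1:ℤ) < α j)).sup id

/-- `α^{O_Y(1)} = (α_2, …, α_{ℓ_{-1}(α)}, 0, …, 0)` for `α ∈ BKT(k, 2n+1)` with
`α_1 = 2n+1-k`. -/
def OY1bkt (k : ℕ) (α : ℕ → ℤ) (j : ℕ) : ℤ :=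
  if 1 ≤ j ∧ j + 1 ≤ ellNeg k α then α (j+1) else 0

/-! ### Correspondences between partitions and Weyl group elements -/

/-- The 01-word correspondence between `μ ∈ BC(k, 2n+2)` and `w ∈ W^P`: for a 1-indexed
value `a ∈ {1, …, n+1}`, `a` occurs among the first `k` values of `w` iff `D(μ)(a) = 1`,
and `bar a` occurs iff `D(μ)(2n+3-a) = 1`. -/
def BCrel (n k : ℕ) (μ : ℕ → ℤ) (w : Equiv.Perm (Fin (2*n+2))) : Prop :=
  ∀ i, 1 ≤ i → i ≤ n+1 →
    ((fn n (i-1) ∈ valSet n k w) ↔ Dword k (2*n+2) μ i) ∧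
    ((fn n (2*n+2-i) ∈ valSet n k w) ↔ Dword k (2*n+2) μ (2*n+3-i))

/-- The BKT correspondence between `β ∈ BKT(k, 2n+2)` and `w ∈ W^P`:
`β_j = 2n+3-k-w(j) + #{i < j : w(i)+w(j) > 2n+3}` (1-indexed values). -/
def BKTrel (n k : ℕ) (β : ℕ → ℤ) (w : Equiv.Perm (Fin (2*n+2))) : Prop :=
  ∀ j, 1 ≤ j → j ≤ k →
    β j = 2*(n:ℤ)+3-k - ((w (fn n (j-1)) : ℕ) + 1) +
      (((Finset.Icc 1 (j-1)).filter
        (fun i => 2*n+1 < (w (fn n (i-1)) : ℕ) + (w (fn n (j-1)) : ℕ))).card : ℤ)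


theorem lt_of_forall_lt_succ {f : ℕ → ℕ} {l u : ℕ}
    (h : ∀ i, l ≤ i → i < u → f i < f (i+1)) {i j : ℕ} (hi : l ≤ i) (hij : i < j)
    (hj : j ≤ u) : f i < f j := by
  induction j, hij using Nat.le_induction with
  | base => exact h i hi hj
  | succ j hij ih => exact (ih (by omega)).trans (h j (by omega) (by omega))

theorem fn_val {m i : ℕ} (hi : i < 2*m+2) : (fn m i : ℕ) = i := Nat.mod_eq_of_lt hi

theorem bar_fn {m i : ℕ} (hi : i < 2*m+2) : bar m (fn m i) = fn m (2*m+1 - i) := by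
  ext
  simp only [bar, fn_val hi]
  exact (fn_val (by omega)).symm

theorem Weyl.apply_bar {m : ℕ} {w : Equiv.Perm (Fin (2*m+2))} (hw : w ∈ Weyl m)
    (x : Fin (2*m+2)) : w (bar m x) = bar m (w x) := by
  have h := Subgroup.mem_centralizer_singleton_iff.mp hw
  exact DFunLike.congr_fun h x

/-- The part of the BKT-partition in the position carrying `bar a_p`: the number of elements of
`{2, …, a_p - 1}` minus the number of `a_i` below `a_p`. -/
theorem BKTrel.part_eq {n k r p : ℕ} {w : Equiv.Perm (Fin (2*n+2))} {α : ℕ → ℤ} {a : ℕ → ℕ}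
    (hrel : BKTrel n k (addOne k α) w)
    (hbnd : ∀ i, 1 ≤ i → i ≤ k → 1 ≤ a i ∧ a i ≤ n+1)
    (hinj : Set.InjOn a (Finset.Icc 1 k))
    (hinc2 : ∀ i, r+1 ≤ i → i < k → a i < a (i+1))
    (hun : ∀ i, 1 ≤ i → i ≤ r → w (fn n (i-1)) = fn n (a i - 1))
    (hbar : ∀ i, r+1 ≤ i → i ≤ k → w (fn n (k+r-i)) = fn n (2*n+2 - a i))
    (hrp : r+1 ≤ p) (hpk : p ≤ k) :
    α (k+r+1-p) = (a p : ℤ) - 2 - (((Finset.Icc 1 k).filter (fun i => a i < a p)).card : ℤ) := by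
  have hp := hbnd p (by omega) hpk
  have h := hrel (k+r+1-p) (by omega) (by omega)
  have hj : k+r+1-p-1 = k+r-p := by omega
  rw [hj, hbar p hrp hpk, fn_val (by omega), addOne, if_pos (by omega)] at h
  have hlow : ((Finset.Icc 1 (k+r-p)).filter
      (fun i => ¬ 2*n+1 < (w (fn n (i-1)) : ℕ) + (2*n+2 - a p)))
      = (Finset.Icc 1 r).filter (fun i => a i < a p) := by
    ext i
    simp only [Finset.mem_filter, Finset.mem_Icc]
    constructor
    · rintro ⟨⟨h1, h2⟩, h3⟩
      by_cases hir : i ≤ r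
      · have hi := hbnd i h1 (by omega)
        rw [hun i h1 hir, fn_val (by omega)] at h3
        have hne : a i ≠ a p := fun he => by
          have := hinj (Finset.mem_coe.2 (Finset.mem_Icc.2 ⟨h1, by omega⟩))
            (Finset.mem_coe.2 (Finset.mem_Icc.2 ⟨by omega, hpk⟩)) he
          omega
        omega
      · have hb := hbar (k+r+1-i) (by omega) (by omega)
        have hi := hbnd (k+r+1-i) (by omega) (by omega)
        rw [show k+r-(k+r+1-i) = i-1 by omega] at hb
        rw [hb, fn_val (by omega)] at h3
        omega
    · rintro ⟨⟨h1, h2⟩, h3⟩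
      have hi := hbnd i h1 (by omega)
      rw [hun i h1 h2, fn_val (by omega)]
      omega
  have hsum := Finset.card_filter_add_card_filter_not (s := Finset.Icc 1 (k+r-p))
    (fun i => 2*n+1 < (w (fn n (i-1)) : ℕ) + (2*n+2 - a p))
  rw [hlow, Nat.card_Icc] at hsum
  have hsplit : (Finset.Icc 1 k).filter (fun i => a i < a p)
      = (Finset.Icc 1 r).filter (fun i => a i < a p) ∪ Finset.Ico (r+1) p := by
    ext i
    simp only [Finset.mem_filter, Finset.mem_Icc, Finset.mem_union, Finset.mem_Ico]
    constructor
    · rintro ⟨⟨h1, h2⟩, h3⟩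
      by_cases hir : i ≤ r
      · exact Or.inl ⟨⟨h1, hir⟩, h3⟩
      · refine Or.inr ⟨by omega, ?_⟩
        by_contra! hpi
        rcases hpi.eq_or_lt with rfl | hlt
        · omega
        · have := lt_of_forall_lt_succ hinc2 hrp hlt h2
          omega
    · rintro (⟨⟨h1, h2⟩, h3⟩ | ⟨h1, h2⟩)
      · exact ⟨⟨h1, by omega⟩, h3⟩
      · exact ⟨⟨by omega, by omega⟩, lt_of_forall_lt_succ hinc2 h1 h2 hpk⟩
  have hdisj : Disjoint ((Finset.Icc 1 r).filter (fun i => a i < a p)) (Finset.Ico (r+1) p) := by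
    rw [Finset.disjoint_left]
    intro i
    simp only [Finset.mem_filter, Finset.mem_Icc, Finset.mem_Ico]
    omega
  rw [hsplit, Finset.card_union_of_disjoint hdisj, Nat.card_Ico]
  omega

theorem card_filter_lt_eq {k p : ℕ} {a : ℕ → ℕ} (hinj : Set.InjOn a (Finset.Icc 1 k))
    (h2 : ∀ i, 1 ≤ i → i ≤ k → 2 ≤ a i)
    (hsub : ∀ x, 2 ≤ x → x ≤ a p → ∃ i, 1 ≤ i ∧ i ≤ k ∧ a i = x) :
    ((Finset.Icc 1 k).filter (fun i => a i < a p)).card = a p - 2 := by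
  rw [← Finset.card_image_of_injOn (hinj.mono (Finset.coe_subset.2 (Finset.filter_subset _ _))),
    ← Nat.card_Ico]
  congr 1
  ext x
  simp only [Finset.mem_image, Finset.mem_filter, Finset.mem_Icc, Finset.mem_Ico]
  constructor
  · rintro ⟨i, ⟨⟨h1, hk⟩, hlt⟩, rfl⟩
    exact ⟨h2 i h1 hk, hlt⟩
  · rintro ⟨hx, hlt⟩
    obtain ⟨i, h1, hk, rfl⟩ := hsub x hx hlt.le
    exact ⟨i, ⟨⟨h1, hk⟩, hlt⟩, rfl⟩

theorem card_filter_lt_lt {k p : ℕ} {a : ℕ → ℕ} (hinj : Set.InjOn a (Finset.Icc 1 k))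
    (h2 : ∀ i, 1 ≤ i → i ≤ k → 2 ≤ a i) (hp1 : 1 ≤ p) (hpk : p ≤ k)
    (hsub : ¬ ∀ x, 2 ≤ x → x ≤ a p → ∃ i, 1 ≤ i ∧ i ≤ k ∧ a i = x) :
    ((Finset.Icc 1 k).filter (fun i => a i < a p)).card < a p - 2 := by
  push Not at hsub
  obtain ⟨x, hx2, hxp, hx⟩ := hsub
  rw [← Finset.card_image_of_injOn (hinj.mono (Finset.coe_subset.2 (Finset.filter_subset _ _))),
    ← Nat.card_Ico]
  refine Finset.card_lt_card (Finset.ssubset_iff_of_subset ?_ |>.2 ⟨x, ?_, ?_⟩)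
  · intro y
    simp only [Finset.mem_image, Finset.mem_filter, Finset.mem_Icc, Finset.mem_Ico]
    rintro ⟨i, ⟨⟨h1, hk⟩, hlt⟩, rfl⟩
    exact ⟨h2 i h1 hk, hlt⟩
  · exact Finset.mem_Ico.2 ⟨hx2, lt_of_le_of_ne hxp (hx p hp1 hpk).symm⟩
  · simp only [Finset.mem_image, Finset.mem_filter, Finset.mem_Icc]
    rintro ⟨i, ⟨⟨h1, hk⟩, -⟩, he⟩
    exact hx i h1 hk he

/-- Values of the BKT-partition `α ∈ BKT(k, 2n+1)` corresponding to
`w ∈ W^{odd} ∩ W^P` with `w(1) > 1`.  Here `w` is given in the form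
`(a_1 < a_2 < ⋯ < a_r < bar a_k < ⋯ < bar a_{r+1})`: the first `r` positions carry the
unbarred values `a_1, …, a_r`, and position `k+r+1-i` carries `bar a_i` for
`r+1 ≤ i ≤ k` (all 1-indexed, `fn n (2*n+2 - a)` being the 0-indexed form of `bar a`). -/
theorem statement17 (n k : ℕ) (hn : 1 ≤ n) (hk : 1 ≤ k) (hk' : k ≤ n+1)
    (w : Equiv.Perm (Fin (2*n+2))) (hw : isMinRep n k w) (hwodd : isOdd n w)
    (α : ℕ → ℤ) (hα : IsBKTodd n k α) (hrel : BKTrel n k (addOne k α) w)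
    (r : ℕ) (a : ℕ → ℕ) (hr0 : 0 ≤ r) (hrk : r ≤ k) (ha1 : 2 ≤ a 1)
    (hbnd : ∀ i, 1 ≤ i → i ≤ k → 1 ≤ a i ∧ a i ≤ n+1)
    (hinc1 : ∀ i, 1 ≤ i → i < r → a i < a (i+1))
    (hinc2 : ∀ i, r+1 ≤ i → i < k → a i < a (i+1))
    (hun : ∀ i, 1 ≤ i → i ≤ r → w (fn n (i-1)) = fn n (a i - 1))
    (hbar : ∀ i, r+1 ≤ i → i ≤ k → w (fn n (k+r-i)) = fn n (2*n+2 - a i)) :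
    -- (1) all entries unbarred
    (r = k → 1 ≤ α k) ∧
    -- (2) `{2, …, a_{r+1}} ⊄ {a_1, a_2, …, a_k}`
    (r < k → ¬(∀ x, 2 ≤ x → x ≤ a (r+1) → ∃ i, 1 ≤ i ∧ i ≤ k ∧ a i = x) →
      1 ≤ α k) ∧
    -- (3) `{2, …, a_k} ⊆ {a_1, a_2, …, a_k}`
    (r < k → (∀ x, 2 ≤ x → x ≤ a k → ∃ i, 1 ≤ i ∧ i ≤ k ∧ a i = x) →
      α (r+1) = 0 ∧ α k = 0) ∧
    -- (4) `t` largest with `{2, …, a_t} ⊆ {a_1, …, a_k}`, and `w(s) = bar a_t`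
    (∀ t s, r+1 ≤ t → t < k →
      (∀ x, 2 ≤ x → x ≤ a t → ∃ i, 1 ≤ i ∧ i ≤ k ∧ a i = x) →
      (∀ t', t < t' → t' ≤ k →
        ¬(∀ x, 2 ≤ x → x ≤ a t' → ∃ i, 1 ≤ i ∧ i ≤ k ∧ a i = x)) →
      1 ≤ s → s ≤ k → w (fn n (s-1)) = fn n (2*n+2 - a t) →
      α s = 0 ∧ α k = 0) := by
  have hge : ∀ i, 1 ≤ i → i ≤ k → 2 ≤ a i := by
    intro i h1 hik
    by_cases hir : i ≤ r
    · rcases h1.eq_or_lt with rfl | hlt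
      · exact ha1
      · exact ha1.trans (lt_of_forall_lt_succ hinc1 le_rfl hlt hir).le
    · by_contra! hlt
      have hai : a i = 1 := by have := hbnd i h1 hik; omega
      have hb := hbar i (by omega) hik
      rw [hai] at hb
      exact hwodd _ (by rw [fn_val (by omega)]; omega) hb
  have hne : ∀ i j, 1 ≤ i → i ≤ r → r+1 ≤ j → j ≤ k → a i ≠ a j := by
    intro i j h1 hir hrj hjk he
    have hi := hbnd i h1 (by omega)
    have hi2 := hge i h1 (by omega)
    have h := Weyl.apply_bar hw.1 (fn n (i-1))
    rw [hun i h1 hir, bar_fn (by omega), bar_fn (by omega),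
      show 2*n+1 - (a i - 1) = 2*n+2 - a j by omega, ← hbar j hrj hjk] at h
    have hv := congrArg Fin.val (w.injective h)
    rw [fn_val (by omega), fn_val (by omega)] at hv
    omega
  have hlt_ne : ∀ i j, 1 ≤ i → i < j → j ≤ k → a i ≠ a j := by
    intro i j h1 hij hjk
    by_cases hjr : j ≤ r
    · exact (lt_of_forall_lt_succ hinc1 h1 hij hjr).ne
    · by_cases hir : i ≤ r
      · exact hne i j h1 hir (by omega) hjk
      · exact (lt_of_forall_lt_succ hinc2 (by omega) hij hjk).ne
  have hinj : Set.InjOn a (Finset.Icc 1 k) := by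
    intro i hi j hj he
    rw [Finset.mem_coe, Finset.mem_Icc] at hi hj
    rcases lt_trichotomy i j with h | h | h
    · exact absurd he (hlt_ne i j hi.1 h hj.2)
    · exact h
    · exact absurd he.symm (hlt_ne j i hj.1 h hi.2)
  have hpart : ∀ p, r+1 ≤ p → p ≤ k → _ := fun p h1 h2 =>
    hrel.part_eq hbnd hinj hinc2 hun hbar h1 h2
  have hzero : ∀ p, r+1 ≤ p → p ≤ k →
      (∀ x, 2 ≤ x → x ≤ a p → ∃ i, 1 ≤ i ∧ i ≤ k ∧ a i = x) → α (k+r+1-p) = 0 := by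
    intro p h1 h2 hsub
    have := hge p (by omega) h2
    rw [hpart p h1 h2, card_filter_lt_eq hinj hge hsub]
    omega
  have hzero_last : ∀ p, r+1 ≤ p → p ≤ k →
      (∀ x, 2 ≤ x → x ≤ a p → ∃ i, 1 ≤ i ∧ i ≤ k ∧ a i = x) → α k = 0 := by
    intro p h1 h2 hsub
    have hle : a (r+1) ≤ a p := by
      rcases h1.eq_or_lt with rfl | hlt
      · exact le_rfl
      · exact (lt_of_forall_lt_succ hinc2 le_rfl hlt h2).le
    have h := hzero (r+1) le_rfl (by omega) (fun x hx hxa => hsub x hx (hxa.trans hle))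
    rwa [show k+r+1-(r+1) = k by omega] at h
  refine ⟨?_, ?_, ?_, ?_⟩
  · rintro rfl
    have hcard : r ≤ n := by
      have h := Finset.card_le_card_of_injOn (t := Finset.Icc 2 (n+1)) a
        (fun i hi => by
          rw [Finset.mem_coe, Finset.mem_Icc] at hi ⊢
          exact ⟨hge i hi.1 hi.2, (hbnd i hi.1 hi.2).2⟩) hinj
      rw [Nat.card_Icc, Nat.card_Icc] at h
      omega
    have h := hrel r hk le_rfl
    have hb := hbnd r hk le_rfl
    rw [hun r hk le_rfl, fn_val (by omega), addOne, if_pos ⟨hk, le_rfl⟩] at h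
    omega
  · intro hr hsub
    have h := hpart (r+1) le_rfl hr
    have hlt := card_filter_lt_lt (p := r+1) hinj hge (by omega) hr hsub
    rw [show k+r+1-(r+1) = k by omega] at h
    omega
  · intro hr hsub
    refine ⟨?_, hzero_last k hr le_rfl hsub⟩
    have h := hzero k hr le_rfl hsub
    rwa [show k+r+1-k = r+1 by omega] at h
  · intro t s hrt htk hsub _ hs1 hsk hws
    refine ⟨?_, hzero_last t hrt htk.le hsub⟩
    have hs := congrArg Fin.val (w.injective (hws.trans (hbar t hrt htk.le).symm))
    rw [fn_val (by omega), fn_val (by omega)] at hs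
    have h := hzero t hrt htk.le hsub
    rwa [show k+r+1-t = s by omega] at h

end
end OddSymplectic
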